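/- Let P be a standard parabolic submonoid of M satisfying Assumption 1 and let g ∈ M be P-reduced. Then there is a unique maximal left-divisor R_P(g) of g which is a P-ribbon (i.e. R_P(g) is a P-ribbon left-dividing g, and every P-ribbon left-dividing g left-divides R_P(g)). Moreover, writing g = R_P(g) g', the element g' is P^{R_P(g)}-reduced, and the following are equivalent: (i) R_P(g) = 1; (ii) every atom which left-divides Δ_P g lies in P. -/

import Mathlib

/-!
Common setting: Garside monoids, standard parabolic submonoids, heads,
ribbons, following Digne–Michel, "Ribbons in Garside monoids".
-/

namespace GarsidePaper

variable {M : Type*}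

/-- `a` left-divides `b` : `b = a * c` for some `c`. -/
def LDvd [Monoid M] (a b : M) : Prop := ∃ c, b = a * c

/-- `a` right-divides `b` : `b = c * a` for some `c`. -/
def RDvd [Monoid M] (a b : M) : Prop := ∃ c, b = c * a

/-- `a` is a factor of `b` : `a` left-divides a right-divisor of `b`. -/
def IsFactor [Monoid M] (a b : M) : Prop := ∃ c, LDvd a c ∧ RDvd c b

/-- A Garside structure on a (left- and right-) cancellative monoid `M`:
left/right gcds and lcms, Noetherianity, and a Garside element `Δ`. -/
structure GarsideStruct (M : Type*) [CancelMonoid M] where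
  /-- left-gcd : gcd for the left-divisibility order -/
  lgcd : M → M → M
  lgcd_dvd_left : ∀ a b, LDvd (lgcd a b) a
  lgcd_dvd_right : ∀ a b, LDvd (lgcd a b) b
  lgcd_greatest : ∀ a b d, LDvd d a → LDvd d b → LDvd d (lgcd a b)
  /-- right-lcm : lcm for the left-divisibility order -/
  rlcm : M → M → M
  ldvd_rlcm_left : ∀ a b, LDvd a (rlcm a b)
  ldvd_rlcm_right : ∀ a b, LDvd b (rlcm a b)
  rlcm_least : ∀ a b m, LDvd a m → LDvd b m → LDvd (rlcm a b) m
  /-- right-gcd : gcd for the right-divisibility order -/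
  rgcd : M → M → M
  rgcd_dvd_left : ∀ a b, RDvd (rgcd a b) a
  rgcd_dvd_right : ∀ a b, RDvd (rgcd a b) b
  rgcd_greatest : ∀ a b d, RDvd d a → RDvd d b → RDvd d (rgcd a b)
  /-- left-lcm : lcm for the right-divisibility order -/
  llcm : M → M → M
  rdvd_llcm_left : ∀ a b, RDvd a (llcm a b)
  rdvd_llcm_right : ∀ a b, RDvd b (llcm a b)
  llcm_least : ∀ a b m, RDvd a m → RDvd b m → RDvd (llcm a b) m
  /-- Noetherian: no infinite sequence where each term is a proper factor
  of the previous one. -/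
  noetherian : WellFounded (fun a b : M => IsFactor a b ∧ a ≠ b)
  /-- the Garside element -/
  Δ : M
  /-- the left- and right-divisors of `Δ` coincide -/
  delta_balanced : ∀ a : M, LDvd a Δ ↔ RDvd a Δ
  /-- the divisors of `Δ` generate `M` -/
  delta_generates : Submonoid.closure {a : M | LDvd a Δ} = ⊤

variable [CancelMonoid M]

/-- An atom: an element with no proper nontrivial divisor (factor). -/
def IsAtom' (a : M) : Prop := a ≠ 1 ∧ ∀ b : M, IsFactor b a → b = 1 ∨ b = a

/-- A standard parabolic submonoid: a submonoid closed under factors in which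
every element of `M` has a maximal left-divisor (the left `P`-head) and a
maximal right-divisor (the right `P`-head) lying in `P`. -/
structure IsStdParabolic (P : Submonoid M) : Prop where
  factor_closed : ∀ a b : M, b ∈ P → IsFactor a b → a ∈ P
  exists_left_head : ∀ g : M, ∃ h, h ∈ P ∧ LDvd h g ∧
    ∀ h', h' ∈ P → LDvd h' g → LDvd h' h
  exists_right_head : ∀ g : M, ∃ h, h ∈ P ∧ RDvd h g ∧
    ∀ h', h' ∈ P → RDvd h' g → RDvd h' h

/-- `h` is the left `P`-head `H_P g` of `g` : the maximal left-divisor of `g`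
lying in `P`. -/
def IsLeftHead (P : Set M) (g h : M) : Prop :=
  h ∈ P ∧ LDvd h g ∧ ∀ h', h' ∈ P → LDvd h' g → LDvd h' h

/-- `h` is the right `P`-head of `g` : the maximal right-divisor of `g`
lying in `P`. -/
def IsRightHead (P : Set M) (g h : M) : Prop :=
  h ∈ P ∧ RDvd h g ∧ ∀ h', h' ∈ P → RDvd h' g → RDvd h' h

/-- `g` is `P`-reduced : `H_P g = 1`, i.e. the only left-divisor of `g`
lying in `P` is `1`. -/
def PReduced (P : Set M) (g : M) : Prop := ∀ h ∈ P, LDvd h g → h = 1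

/-- `P ^ g` is defined: `p ^ g` is defined (`g ≼ p * g`) for every `p ∈ P`. -/
def ConjSetDef (P : Set M) (g : M) : Prop := ∀ p ∈ P, LDvd g (p * g)

/-- The set `P ^ g = { p ^ g : p ∈ P }`, where `p ^ g` is the unique `c`
with `p * g = g * c`. -/
def conjSet (P : Set M) (g : M) : Set M := {c : M | ∃ p ∈ P, p * g = g * c}

/-- A `P`-ribbon: a `P`-reduced element `g` such that `P ^ g` is defined. -/
def IsRibbon (P : Set M) (g : M) : Prop := PReduced P g ∧ ConjSetDef P g

/-- `P` is the smallest standard parabolic submonoid containing `S₁`. -/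
def IsSmallestParabolicContaining (S₁ : Set M) (P : Submonoid M) : Prop :=
  IsStdParabolic P ∧ S₁ ⊆ (P : Set M) ∧
    ∀ Q : Submonoid M, IsStdParabolic Q → S₁ ⊆ (Q : Set M) → P ≤ Q

/-- Assumption 1: for any set `S₁` of atoms, the right-lcm of `S₁` is the
Garside element `Δ_{P₁} = H_{P₁}(Δ)` of the smallest standard parabolic
submonoid `P₁` containing `S₁`. -/
def Assumption1 (G : GarsideStruct M) : Prop :=
  ∀ S₁ : Set M, (∀ s ∈ S₁, IsAtom' s) →
    ∀ P₁ : Submonoid M, IsSmallestParabolicContaining S₁ P₁ →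
      ∀ d : M, IsLeftHead (P₁ : Set M) G.Δ d →
        (∀ s ∈ S₁, LDvd s d) ∧ ∀ m : M, (∀ s ∈ S₁, LDvd s m) → LDvd d m

/-- Assumption 2: some (positive) power of `Δ` is central. -/
def Assumption2 (G : GarsideStruct M) : Prop :=
  ∃ n : ℕ, 0 < n ∧ ∀ x : M, G.Δ ^ n * x = x * G.Δ ^ n

/-- `v = v_{s,P}` : the element defined by `Δ_{P_s} = Δ_P * v`, where `P_s`
is the smallest standard parabolic submonoid containing `P` and `s`. -/
def IsVsp (G : GarsideStruct M) (P : Submonoid M) (s v : M) : Prop :=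
  ∃ Ps : Submonoid M, IsSmallestParabolicContaining ((P : Set M) ∪ {s}) Ps ∧
    ∃ dP dPs : M, IsLeftHead (P : Set M) G.Δ dP ∧
      IsLeftHead (Ps : Set M) G.Δ dPs ∧ dPs = dP * v

theorem LDvd.refl (a : M) : LDvd a a := ⟨1, (mul_one a).symm⟩

theorem LDvd.trans {a b c : M} (hab : LDvd a b) (hbc : LDvd b c) : LDvd a c := by
  obtain ⟨x, rfl⟩ := hab
  obtain ⟨y, rfl⟩ := hbc
  exact ⟨x * y, mul_assoc _ _ _⟩

theorem LDvd.mul_left {a b : M} (h : LDvd a b) (c : M) : LDvd (c * a) (c * b) := by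
  obtain ⟨x, rfl⟩ := h
  exact ⟨x, (mul_assoc _ _ _).symm⟩

theorem LDvd.of_mul_left {a b c : M} (h : LDvd (c * a) (c * b)) : LDvd a b := by
  obtain ⟨x, hx⟩ := h
  exact ⟨x, mul_left_cancel (hx.trans (mul_assoc _ _ _))⟩

theorem LDvd.isFactor {a b : M} (h : LDvd a b) : IsFactor a b :=
  ⟨b, h, 1, (one_mul b).symm⟩

theorem RDvd.isFactor {a b : M} (h : RDvd a b) : IsFactor a b :=
  ⟨a, LDvd.refl a, h⟩

namespace GarsideStruct

theorem isFactor_antisymm (G : GarsideStruct M) {a b : M} (hab : IsFactor a b)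
    (hba : IsFactor b a) : a = b := by
  by_contra h
  exact G.noetherian.asymmetric a b ⟨hab, h⟩ ⟨hba, Ne.symm h⟩

theorem ldvd_antisymm (G : GarsideStruct M) {a b : M} (hab : LDvd a b) (hba : LDvd b a) :
    a = b :=
  G.isFactor_antisymm hab.isFactor hba.isFactor

theorem eq_one_of_ldvd_one (G : GarsideStruct M) {a : M} (h : LDvd a 1) : a = 1 :=
  G.ldvd_antisymm h ⟨a, (one_mul a).symm⟩

theorem exists_isAtom_ldvd (G : GarsideStruct M) (x : M) (hx : x ≠ 1) :
    ∃ a, IsAtom' a ∧ LDvd a x := by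
  induction x using G.noetherian.induction with
  | _ x ih =>
    by_cases hatom : IsAtom' x
    · exact ⟨x, hatom, LDvd.refl x⟩
    obtain ⟨y, hyx, hne, hy1⟩ : ∃ y, LDvd y x ∧ y ≠ x ∧ y ≠ 1 := by
      simp only [IsAtom', not_and, not_forall, not_or] at hatom
      obtain ⟨b, ⟨_, ⟨w, rfl⟩, u, rfl⟩, hb1, hbx⟩ := hatom hx
      by_cases hu : u = 1
      · subst hu
        exact ⟨b, ⟨w, one_mul _⟩, hbx, hb1⟩
      · refine ⟨u, ⟨b * w, rfl⟩, fun h => hb1 ?_, hu⟩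
        exact G.eq_one_of_ldvd_one ⟨w, mul_left_cancel ((mul_one u).trans h)⟩
    obtain ⟨a, ha, hay⟩ := ih y ⟨hyx.isFactor, hne⟩ hy1
    exact ⟨a, ha, hay.trans hyx⟩

end GarsideStruct

/-- A standard parabolic submonoid is generated by its atoms. -/
theorem IsStdParabolic.mem_of_atoms_mem (G : GarsideStruct M) {P : Submonoid M}
    (hP : IsStdParabolic P) {Q : Submonoid M} (h : ∀ a ∈ P, IsAtom' a → a ∈ Q) :
    P ≤ Q := by
  intro x
  induction x using G.noetherian.induction with
  | _ x ih =>
    intro hx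
    by_cases hx1 : x = 1
    · exact hx1 ▸ Q.one_mem
    obtain ⟨a, ha, y, rfl⟩ := G.exists_isAtom_ldvd x hx1
    have hy : IsFactor y (a * y) := RDvd.isFactor ⟨a, rfl⟩
    refine Q.mul_mem (h a (hP.factor_closed _ _ hx (LDvd.isFactor ⟨y, rfl⟩)) ha)
      (ih y ⟨hy, fun he => ha.1 ?_⟩ (hP.factor_closed _ _ hx hy))
    exact mul_right_cancel (he.symm.trans (one_mul y).symm)

theorem isStdParabolic_sInf (G : GarsideStruct M) {C : Set (Submonoid M)}
    (hC : ∀ Q ∈ C, IsStdParabolic Q) : IsStdParabolic (sInf C) where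
  factor_closed a b hb hab := by
    rw [Submonoid.mem_sInf] at hb ⊢
    exact fun Q hQ => (hC Q hQ).factor_closed a b (hb Q hQ) hab
  exists_left_head g := by
    obtain ⟨h, ⟨hg, hmax⟩, hmin⟩ := G.noetherian.has_min
      {h | LDvd h g ∧ ∀ h' ∈ sInf C, LDvd h' g → LDvd h' h} ⟨g, LDvd.refl g, fun _ _ h => h⟩
    refine ⟨h, Submonoid.mem_sInf.2 fun Q hQ => ?_, hg, hmax⟩
    obtain ⟨k, hkQ, hkh, hk⟩ := (hC Q hQ).exists_left_head h
    by_contra hhQ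
    refine hmin k ⟨hkh.trans hg, fun h' hh' hh'g => ?_⟩
      ⟨hkh.isFactor, fun he => hhQ (he ▸ hkQ)⟩
    exact hk h' (Submonoid.mem_sInf.1 hh' Q hQ) (hmax h' hh' hh'g)
  exists_right_head g := by
    obtain ⟨h, ⟨⟨c, hc⟩, hmax⟩, hmin⟩ := G.noetherian.has_min
      {h | RDvd h g ∧ ∀ h' ∈ sInf C, RDvd h' g → RDvd h' h}
      ⟨g, ⟨1, (one_mul g).symm⟩, fun _ _ h => h⟩
    refine ⟨h, Submonoid.mem_sInf.2 fun Q hQ => ?_, ⟨c, hc⟩, hmax⟩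
    obtain ⟨k, hkQ, hkh, hk⟩ := (hC Q hQ).exists_right_head h
    by_contra hhQ
    refine hmin k ⟨?_, fun h' hh' hh'g => ?_⟩ ⟨hkh.isFactor, fun he => hhQ (he ▸ hkQ)⟩
    · obtain ⟨d, rfl⟩ := hkh
      exact ⟨c * d, by rw [hc, mul_assoc]⟩
    · exact hk h' (Submonoid.mem_sInf.1 hh' Q hQ) (hmax h' hh' hh'g)

theorem GarsideStruct.exists_isSmallestParabolicContaining (G : GarsideStruct M) (S₁ : Set M) :
    ∃ P : Submonoid M, IsSmallestParabolicContaining S₁ P :=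
  ⟨sInf {Q | IsStdParabolic Q ∧ S₁ ⊆ (Q : Set M)}, isStdParabolic_sInf G fun _ hQ => hQ.1,
    fun _ hs => Submonoid.mem_sInf.2 fun _ hQ => hQ.2 hs,
    fun _ hQ hS => sInf_le ⟨hQ, hS⟩⟩

section Delta

variable {G : GarsideStruct M} {P : Submonoid M} {d : M}

/-- The head `Δ_P` of `Δ` is balanced. -/
theorem IsLeftHead.ldvd_iff_rdvd (hP : IsStdParabolic P) (hd : IsLeftHead (P : Set M) G.Δ d)
    (x : M) : LDvd x d ↔ RDvd x d := by
  obtain ⟨hdP, hdΔ, hmax⟩ := hd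
  obtain ⟨e, heP, heΔ, hemax⟩ := hP.exists_right_head G.Δ
  obtain rfl : d = e := G.isFactor_antisymm
    (RDvd.isFactor (hemax d hdP ((G.delta_balanced d).1 hdΔ)))
    (LDvd.isFactor (hmax e heP ((G.delta_balanced e).2 heΔ)))
  constructor <;> intro hx
  · exact hemax x (hP.factor_closed _ _ hdP hx.isFactor)
      ((G.delta_balanced x).1 (hx.trans hdΔ))
  · have hxP := hP.factor_closed _ _ hdP hx.isFactor
    obtain ⟨a, ha⟩ := hx
    obtain ⟨b, hb⟩ := heΔ
    exact hmax x hxP ((G.delta_balanced x).2 ⟨b * a, by rw [hb, mul_assoc, ← ha]⟩)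

theorem IsLeftHead.ldvd_mul_of_ldvd (hP : IsStdParabolic P)
    (hd : IsLeftHead (P : Set M) G.Δ d) {x : M} (hx : LDvd x d) : LDvd d (x * d) := by
  obtain ⟨y, hy⟩ := hx
  obtain ⟨z, hz⟩ := (hd.ldvd_iff_rdvd hP y).2 ⟨x, hy⟩
  exact ⟨z, by rw [hz, ← mul_assoc, ← hy, hz]⟩

theorem IsLeftHead.exists_mul_eq_of_ldvd (hP : IsStdParabolic P)
    (hd : IsLeftHead (P : Set M) G.Δ d) {x : M} (hx : LDvd x d) :
    ∃ z ∈ P, d * x = z * d := by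
  obtain ⟨y, hy⟩ := (hd.ldvd_iff_rdvd hP x).1 hx
  obtain ⟨z, hz⟩ := (hd.ldvd_iff_rdvd hP y).1 ⟨x, hy⟩
  refine ⟨z, hP.factor_closed _ _ hd.1 (LDvd.isFactor ⟨y, hz⟩), ?_⟩
  rw [hy, ← mul_assoc, ← hy, ← hz]

end Delta

/-- The elements whose conjugate by `d` is defined. -/
def conjDomain (d : M) : Submonoid M where
  carrier := {q | LDvd d (q * d)}
  one_mem' := ⟨1, by simp⟩
  mul_mem' := by
    rintro a b ⟨a', ha⟩ ⟨b', hb⟩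
    exact ⟨a' * b', by rw [mul_assoc, hb, ← mul_assoc, ha, mul_assoc]⟩

/-- The elements `p` such that `d * p` lies in the coset `P * d`. -/
def leftConjDomain (P : Submonoid M) (d : M) : Submonoid M where
  carrier := {p | ∃ z ∈ P, d * p = z * d}
  one_mem' := ⟨1, P.one_mem, by simp⟩
  mul_mem' := by
    rintro a b ⟨a', ha', ha⟩ ⟨b', hb', hb⟩
    exact ⟨a' * b', P.mul_mem ha' hb', by rw [← mul_assoc, ha, mul_assoc, hb, mul_assoc]⟩

theorem PReduced.of_ldvd {P : Set M} {g h : M} (hg : PReduced P g) (hh : LDvd h g) :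
    PReduced P h :=
  fun p hp hph => hg p hp (hph.trans hh)

theorem ConjSetDef.rlcm (G : GarsideStruct M) {P : Set M} {a b : M} (ha : ConjSetDef P a)
    (hb : ConjSetDef P b) : ConjSetDef P (G.rlcm a b) := fun p hp =>
  G.rlcm_least _ _ _ ((ha p hp).trans ((G.ldvd_rlcm_left a b).mul_left p))
    ((hb p hp).trans ((G.ldvd_rlcm_right a b).mul_left p))

theorem exists_maximal_ribbon (G : GarsideStruct M) {P : Set M} {g : M} (hred : PReduced P g) :
    ∃ r, IsRibbon P r ∧ LDvd r g ∧ ∀ r', IsRibbon P r' → LDvd r' g → LDvd r' r := by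
  obtain ⟨c, ⟨r, hr, hrc⟩, hmin⟩ := G.noetherian.has_min
    {c | ∃ r, IsRibbon P r ∧ g = r * c}
    ⟨g, 1, ⟨hred.of_ldvd ⟨g, (one_mul g).symm⟩, fun p _ => ⟨p, by simp⟩⟩, (one_mul g).symm⟩
  refine ⟨r, hr, ⟨c, hrc⟩, fun r' hr' hr'g => ?_⟩
  have hlg := G.rlcm_least r r' g ⟨c, hrc⟩ hr'g
  have hl : IsRibbon P (G.rlcm r r') := ⟨hred.of_ldvd hlg, hr.2.rlcm G hr'.2⟩
  obtain ⟨e, he⟩ := hlg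
  obtain ⟨x, hx⟩ := G.ldvd_rlcm_left r r'
  have hc : c = x * e := mul_left_cancel (by rw [← hrc, he, hx, mul_assoc])
  have hec : e = c := by
    by_contra hne
    exact hmin e ⟨_, hl, he⟩ ⟨RDvd.isFactor ⟨x, hc⟩, hne⟩
  have : G.rlcm r r' = r := mul_right_cancel (he.symm.trans (hec ▸ hrc))
  exact this ▸ G.ldvd_rlcm_right r r'

section Assumption

variable {G : GarsideStruct M} {P : Submonoid M} {d : M}

theorem Assumption1.isLUB_atoms (hA : Assumption1 G) (hP : IsStdParabolic P)
    (hd : IsLeftHead (P : Set M) G.Δ d) :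
    (∀ s ∈ P, IsAtom' s → LDvd s d) ∧
      ∀ m : M, (∀ s ∈ P, IsAtom' s → LDvd s m) → LDvd d m := by
  obtain ⟨h₁, h₂⟩ := hA {s | s ∈ P ∧ IsAtom' s} (fun _ hs => hs.2) P
    ⟨hP, fun _ hs => hs.1, fun _ _ hQ => hP.mem_of_atoms_mem G fun _ ha ha' => hQ ⟨ha, ha'⟩⟩ d hd
  exact ⟨fun s hs hs' => h₁ s ⟨hs, hs'⟩, fun m hm => h₂ m fun s hs => hm s hs.1 hs.2⟩

/-- If an atom `s` outside `P` left-divides `Δ_P * g`, then so does `Δ_P * v` for some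
nontrivial `v` such that `P ^ v` is defined. -/
theorem Assumption1.exists_conjSetDef_ldvd (hA : Assumption1 G) (hP : IsStdParabolic P)
    (hd : IsLeftHead (P : Set M) G.Δ d) {s g : M} (hs : IsAtom' s) (hsg : LDvd s (d * g))
    (hsP : s ∉ P) : ∃ v, v ≠ 1 ∧ LDvd v g ∧ ConjSetDef (P : Set M) v := by
  obtain ⟨hatoms, hleast⟩ := hA.isLUB_atoms hP hd
  set S₁ : Set M := insert s {a | a ∈ P ∧ IsAtom' a}
  obtain ⟨Q, hQ⟩ := G.exists_isSmallestParabolicContaining S₁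
  obtain ⟨e, he⟩ : ∃ e, IsLeftHead (Q : Set M) G.Δ e := hQ.1.exists_left_head G.Δ
  obtain ⟨hSe, heleast⟩ := hA S₁ (by rintro a (rfl | ha); exacts [hs, ha.2]) Q hQ e he
  obtain ⟨v, rfl⟩ := hleast e fun a ha ha' => hSe a (Or.inr ⟨ha, ha'⟩)
  refine ⟨v, ?_, ?_, fun p hp => ?_⟩
  · rintro rfl
    have hsd := hSe s (Or.inl rfl)
    rw [mul_one] at hsd
    exact hsP (hP.factor_closed _ _ hd.1 hsd.isFactor)
  · refine LDvd.of_mul_left (heleast _ ?_)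
    rintro a (rfl | ha)
    exacts [hsg, (hatoms a ha.1 ha.2).trans ⟨g, rfl⟩]
  · obtain ⟨z, hz, hpz⟩ : p ∈ leftConjDomain P d := hP.mem_of_atoms_mem G
      (fun a ha ha' => hd.exists_mul_eq_of_ldvd hP (hatoms a ha ha')) hp
    have hze : z ∈ conjDomain (d * v) := hP.mem_of_atoms_mem G
      (fun a ha ha' => he.ldvd_mul_of_ldvd hQ.1 (hSe a (Or.inr ⟨ha, ha'⟩))) hz
    have hze' : LDvd (d * v) (z * (d * v)) := hze
    rw [← mul_assoc, ← hpz, mul_assoc] at hze'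
    exact hze'.of_mul_left

end Assumption

/-- for `P`-reduced `g` there is a unique maximal left-divisor
`R_P(g)` of `g` which is a `P`-ribbon; writing `g = R_P(g) * g'`, the element
`g'` is `P^{R_P(g)}`-reduced, and `R_P(g) = 1` iff every atom left-dividing
`Δ_P * g` lies in `P`. -/
theorem statement13 (G : GarsideStruct M) (hA : Assumption1 G)
    (P : Submonoid M) (hP : IsStdParabolic P)
    (g : M) (hred : PReduced (P : Set M) g)
    (dP : M) (hdP : IsLeftHead (P : Set M) G.Δ dP) :
    (∃! r : M, IsRibbon (P : Set M) r ∧ LDvd r g ∧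
      ∀ r' : M, IsRibbon (P : Set M) r' → LDvd r' g → LDvd r' r) ∧
    (∀ r g' : M,
      (IsRibbon (P : Set M) r ∧ LDvd r g ∧
        ∀ r' : M, IsRibbon (P : Set M) r' → LDvd r' g → LDvd r' r) →
      g = r * g' →
      PReduced (conjSet (P : Set M) r) g' ∧
        (r = 1 ↔ ∀ s : M, IsAtom' s → LDvd s (dP * g) → s ∈ P)) := by
  constructor
  · obtain ⟨r, hr, hrg, hmax⟩ := exists_maximal_ribbon G hred
    exact ⟨r, ⟨hr, hrg, hmax⟩, fun r' ⟨hr', hr'g, hmax'⟩ =>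
      G.ldvd_antisymm (hmax r' hr' hr'g) (hmax' r hr hrg)⟩
  rintro r g' ⟨hr, hrg, hmax⟩ hg
  refine ⟨?_, ?_, fun hatoms => ?_⟩
  · rintro c ⟨p, hp, hpc⟩ ⟨x, rfl⟩
    obtain rfl : p = 1 := hred p hp ⟨r * x, by rw [hg, ← mul_assoc, ← hpc, mul_assoc]⟩
    exact mul_left_cancel (a := r) (by rw [← hpc, one_mul, mul_one])
  · rintro rfl s hs hsg
    by_contra hsP
    obtain ⟨v, hv1, hvg, hv⟩ := hA.exists_conjSetDef_ldvd hP hdP hs hsg hsP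
    exact hv1 (G.eq_one_of_ldvd_one (hmax v ⟨hred.of_ldvd hvg, hv⟩ hvg))
  · by_contra hr1
    obtain ⟨a, ha, har⟩ := G.exists_isAtom_ldvd r hr1
    have haP : a ∈ P := hatoms a ha ((har.trans (hr.2 dP hdP.1)).trans (hrg.mul_left dP))
    exact ha.1 (hr.1 a haP har)

end GarsidePaper
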